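/- Simulation characterization with negated labels: for every CTP^¬ node formula φ (CTP extended with negated labels ¬p), every tree T, and every node n of T, one has T,n⊨φ if and only if there exists a negated-label-preserving simulation from the Boolean conditional tree pattern with negation ct(φ) into the pointed tree (T.n, n); the analogous equivalence holds for CTP^¬ path formulas with the output node mapped accordingly. -/

import Mathlib

/- Trees over a label alphabet -/
structure RTree (A : Type) where
  Node : Type
  E : Node → Node → Prop
  root : Node
  label : Node → Set A

namespace RTree
variable {A : Type}

/-- Tree axioms not requiring finiteness of the node set: finite label sets,
    connectedness from the root, unique parents, acyclicity. -/
def IsPreTree (T : RTree A) : Prop :=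
  (∀ n, (T.label n).Finite) ∧
  (∀ n, Relation.ReflTransGen T.E T.root n) ∧
  (∀ n m m', T.E m n → T.E m' n → m = m') ∧
  (∀ n, ¬ Relation.TransGen T.E n n)

/-- A (finite, rooted, unranked) tree. -/
def IsTree (T : RTree A) : Prop := T.IsPreTree ∧ Finite T.Node

/-- Single-labeled (XML) trees: every node carries exactly one label. -/
def SingleLabeled (T : RTree A) : Prop := ∀ n, ∃ p, T.label n = {p}

end RTree

/- CTP with negated labels: node formulas and path formulas.
   `cstar φ` is the conditional descendant path (↓;?φ)*;↓. -/
mutual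
inductive CNFn (A : Type) : Type where
  | lab : A → CNFn A
  | nlab : A → CNFn A
  | top : CNFn A
  | and : CNFn A → CNFn A → CNFn A
  | dia : CPFn A → CNFn A → CNFn A
inductive CPFn (A : Type) : Type where
  | child : CPFn A
  | test : CNFn A → CPFn A
  | comp : CPFn A → CPFn A → CPFn A
  | cstar : CNFn A → CPFn A
end

variable {A : Type}

mutual
/-- Satisfaction of CTP^¬ node formulas; ¬p holds at n iff p ∉ ρ(n). -/
def CNFn.sat (T : RTree A) : CNFn A → Set T.Node
  | .lab p => {n | p ∈ T.label n}
  | .nlab p => {n | p ∉ T.label n}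
  | .top => Set.univ
  | .and φ ψ => {n | n ∈ CNFn.sat T φ ∧ n ∈ CNFn.sat T ψ}
  | .dia α φ => {n | ∃ m, CPFn.sem T α n m ∧ m ∈ CNFn.sat T φ}
/-- Semantics of CTP^¬ path formulas. -/
def CPFn.sem (T : RTree A) : CPFn A → T.Node → T.Node → Prop
  | .child => T.E
  | .test φ => fun n m => n = m ∧ n ∈ CNFn.sat T φ
  | .comp α β => fun n m => ∃ k, CPFn.sem T α n k ∧ CPFn.sem T β k m
  | .cstar φ => fun n m =>
      ∃ k, Relation.ReflTransGen (fun a b => T.E a b ∧ b ∈ CNFn.sat T φ) n k ∧ T.E k m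
end

/-- The subtree of `T` rooted at `n`. -/
def RTree.subtree (T : RTree A) (n : T.Node) : RTree A where
  Node := {m : T.Node // Relation.ReflTransGen T.E n m}
  E a b := T.E a.1 b.1
  root := ⟨n, Relation.ReflTransGen.refl⟩
  label m := T.label m.1

/-- Boolean conditional tree patterns with negation: each node carries a set of
(positive) labels and a set of negated labels; each edge carries either `none`
(a child edge ↓) or `some t` with `t` a Boolean pattern with negation. -/
inductive NBPat (A : Type) : Type where
  | mk : Set A → Set A → List (Option (NBPat A) × NBPat A) → NBPat A

/-- Conditional tree patterns with negation and one output node, given by the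
marked spine from the root to the output node. -/
inductive NOPat (A : Type) : Type where
  | here : Set A → Set A → List (Option (NBPat A) × NBPat A) → NOPat A
  | step : Set A → Set A → List (Option (NBPat A) × NBPat A) →
      Option (NBPat A) → NOPat A → NOPat A

mutual
/-- There exists a negated-label-preserving simulation from the Boolean pattern
with negation into the pointed tree `(T, n)`. -/
def NSimB (T : RTree A) (p : NBPat A) (n : T.Node) : Prop :=
  match p with
  | .mk s sn ch => s ⊆ T.label n ∧ (∀ p' ∈ sn, p' ∉ T.label n) ∧ NSimL T ch n
/-- Simulations for a list of outgoing (labeled) edges of a pattern node. -/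
def NSimL (T : RTree A) (l : List (Option (NBPat A) × NBPat A)) (n : T.Node) : Prop :=
  match l with
  | [] => True
  | (none, t) :: r => (∃ m, T.E n m ∧ NSimB T t m) ∧ NSimL T r n
  | (some c, t) :: r =>
      (∃ m, Relation.TransGen T.E n m ∧ NSimB T t m ∧
        ∀ z, Relation.TransGen T.E n z → Relation.TransGen T.E z m →
          NSimB (T.subtree z) c (T.subtree z).root) ∧ NSimL T r n
end

mutual
/-- There exists a negated-label-preserving simulation from the one-output
pattern into the pointed tree `(T, n)` mapping the output node to `out`. -/
def NSimO (T : RTree A) (p : NOPat A) (n out : T.Node) : Prop :=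
  match p with
  | .here s sn ch =>
      out = n ∧ s ⊆ T.label n ∧ (∀ p' ∈ sn, p' ∉ T.label n) ∧ NSimL T ch n
  | .step s sn ch el rest =>
      s ⊆ T.label n ∧ (∀ p' ∈ sn, p' ∉ T.label n) ∧ NSimL T ch n ∧
      match el with
      | none => ∃ m, T.E n m ∧ NSimO T rest m out
      | some c =>
          ∃ m, Relation.TransGen T.E n m ∧ NSimO T rest m out ∧
            ∀ z, Relation.TransGen T.E n z → Relation.TransGen T.E z m →
              NSimB (T.subtree z) c (T.subtree z).root
end

/-- Fusion of two Boolean patterns with negation at the root. -/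
def NBPat.fuse : NBPat A → NBPat A → NBPat A
  | .mk s sn ch, .mk s' sn' ch' => .mk (s ∪ s') (sn ∪ sn') (ch ++ ch')

/-- Fuse a Boolean pattern onto the output node of a one-output pattern. -/
def NOPat.graft : NOPat A → NBPat A → NBPat A
  | .here s sn ch, .mk s' sn' ch' => .mk (s ∪ s') (sn ∪ sn') (ch ++ ch')
  | .step s sn ch el rest, b => .mk s sn (ch ++ [(el, NOPat.graft rest b)])

/-- Composition of one-output patterns. -/
def NOPat.comp : NOPat A → NOPat A → NOPat A
  | .here s sn ch, .here s' sn' ch' => .here (s ∪ s') (sn ∪ sn') (ch ++ ch')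
  | .here s sn ch, .step s' sn' ch' el rest =>
      .step (s ∪ s') (sn ∪ sn') (ch ++ ch') el rest
  | .step s sn ch el rest, q => .step s sn ch el (NOPat.comp rest q)

mutual
/-- The translation `ct` of CTP^¬ node formulas into Boolean conditional tree
patterns with negation. -/
def ctNn : CNFn A → NBPat A
  | .lab p => .mk {p} ∅ []
  | .nlab p => .mk ∅ {p} []
  | .top => .mk ∅ ∅ []
  | .and φ ψ => NBPat.fuse (ctNn φ) (ctNn ψ)
  | .dia α φ => NOPat.graft (ctPn α) (ctNn φ)
/-- The translation `ct` of CTP^¬ path formulas into conditional tree patterns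
with negation and one output node. -/
def ctPn : CPFn A → NOPat A
  | .child => .step ∅ ∅ [] none (.here ∅ ∅ [])
  | .test φ =>
      match ctNn φ with
      | .mk s sn ch => .here s sn ch
  | .comp α β => NOPat.comp (ctPn α) (ctPn β)
  | .cstar φ => .step ∅ ∅ [] (some (ctNn φ)) (.here ∅ ∅ [])
end

structure REmb (S T : RTree A) (f : S.Node → T.Node) : Prop where
  inj : ∀ a b, f a = f b → a = b
  lab : ∀ a, S.label a = T.label (f a)
  fwd : ∀ a b, S.E a b → T.E (f a) (f b)
  bwd : ∀ a y, T.E (f a) y → ∃ b, f b = y ∧ S.E a b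

theorem REmb.tg {S T : RTree A} {f : S.Node → T.Node} (h : REmb S T f) {a b : S.Node}
    (hab : Relation.TransGen S.E a b) : Relation.TransGen T.E (f a) (f b) :=
  Relation.TransGen.lift (p := T.E) f h.fwd _ _ hab

theorem REmb.tgb {S T : RTree A} {f : S.Node → T.Node} (h : REmb S T f) {a : S.Node} {y : T.Node}
    (hab : Relation.TransGen T.E (f a) y) : ∃ b, f b = y ∧ Relation.TransGen S.E a b := by
  induction hab with
  | single e =>
    obtain ⟨b, hb, e'⟩ := h.bwd _ _ e
    exact ⟨b, hb, .single e'⟩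
  | tail _ e ih =>
    obtain ⟨c, rfl, hc⟩ := ih
    obtain ⟨b, hb, e'⟩ := h.bwd _ _ e
    exact ⟨b, hb, hc.tail e'⟩

theorem REmb.sub (T : RTree A) (n : T.Node) : REmb (T.subtree n) T (fun m => m.1) where
  inj a b h := Subtype.ext h
  lab a := rfl
  fwd a b h := h
  bwd a y h := ⟨⟨y, a.2.tail h⟩, rfl, h⟩

theorem REmb.exE {S T : RTree A} {f : S.Node → T.Node} (h : REmb S T f) (a : S.Node)
    {P : S.Node → Prop} {Q : T.Node → Prop} (hPQ : ∀ m, P m ↔ Q (f m)) :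
    (∃ m, S.E a m ∧ P m) ↔ (∃ m, T.E (f a) m ∧ Q m) := by
  constructor
  · rintro ⟨m, e, hm⟩
    exact ⟨f m, h.fwd _ _ e, (hPQ m).1 hm⟩
  · rintro ⟨m, e, hm⟩
    obtain ⟨b, rfl, e'⟩ := h.bwd _ _ e
    exact ⟨b, e', (hPQ b).2 hm⟩

theorem REmb.exC {S T : RTree A} {f : S.Node → T.Node} (h : REmb S T f) (a : S.Node)
    {P P' : S.Node → Prop} {Q Q' : T.Node → Prop} (hPQ : ∀ m, P m ↔ Q (f m))
    (hPQ' : ∀ m, P' m ↔ Q' (f m)) :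
    (∃ m, Relation.TransGen S.E a m ∧ P m ∧
      ∀ z, Relation.TransGen S.E a z → Relation.TransGen S.E z m → P' z) ↔
    (∃ m, Relation.TransGen T.E (f a) m ∧ Q m ∧
      ∀ z, Relation.TransGen T.E (f a) z → Relation.TransGen T.E z m → Q' z) := by
  constructor
  · rintro ⟨m, e, hm, hz⟩
    refine ⟨f m, h.tg e, (hPQ m).1 hm, fun z h1 h2 => ?_⟩
    obtain ⟨z, rfl, h1'⟩ := h.tgb h1
    obtain ⟨m', hm', h2'⟩ := h.tgb h2
    obtain rfl := h.inj _ _ hm'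
    exact (hPQ' z).1 (hz z h1' h2')
  · rintro ⟨m, e, hm, hz⟩
    obtain ⟨b, rfl, e'⟩ := h.tgb e
    exact ⟨b, e', (hPQ b).2 hm, fun z h1 h2 => (hPQ' z).2 (hz _ (h.tg h1) (h.tg h2))⟩

mutual
theorem NSimB_emb (p : NBPat A) (S T : RTree A) (f : S.Node → T.Node) (h : REmb S T f)
    (a : S.Node) : NSimB S p a ↔ NSimB T p (f a) :=
  match p with
  | .mk s sn ch => by
    rw [NSimB, NSimB, NSimL_emb ch S T f h a, h.lab]
theorem NSimL_emb (l : List (Option (NBPat A) × NBPat A)) (S T : RTree A)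
    (f : S.Node → T.Node) (h : REmb S T f)
    (a : S.Node) : NSimL S l a ↔ NSimL T l (f a) :=
  match l with
  | [] => by simp [NSimL]
  | (none, t) :: r => by
    rw [NSimL, NSimL, NSimL_emb r S T f h a]
    exact and_congr (h.exE a (fun m => NSimB_emb t S T f h m)) Iff.rfl
  | (some c, t) :: r => by
    rw [NSimL, NSimL, NSimL_emb r S T f h a]
    refine and_congr (h.exC a (fun m => NSimB_emb t S T f h m) (fun m => ?_)) Iff.rfl
    exact (NSimB_emb c _ _ _ (REmb.sub S m) _).trans ((NSimB_emb c S T f h m).trans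
      (NSimB_emb c _ _ _ (REmb.sub T (f m)) (T.subtree (f m)).root).symm)
end

theorem NSimB_sub (p : NBPat A) (T : RTree A) (n : T.Node) :
    NSimB (T.subtree n) p (T.subtree n).root ↔ NSimB T p n :=
  NSimB_emb p _ _ _ (REmb.sub T n) _

theorem NSimO_emb (p : NOPat A) (S T : RTree A) (f : S.Node → T.Node) (h : REmb S T f)
    (a b : S.Node) : NSimO S p a b ↔ NSimO T p (f a) (f b) := by
  induction p generalizing a with
  | here s sn ch =>
    rw [NSimO, NSimO, NSimL_emb ch S T f h a, h.lab]
    exact and_congr ⟨fun e => e ▸ rfl, h.inj _ _⟩ Iff.rfl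
  | step s sn ch el rest ih =>
    cases el with
    | none =>
      rw [NSimO, NSimO, NSimL_emb ch S T f h a, h.lab]
      exact and_congr Iff.rfl (and_congr Iff.rfl (and_congr Iff.rfl (h.exE a ih)))
    | some c =>
      rw [NSimO, NSimO, NSimL_emb ch S T f h a, h.lab]
      refine and_congr Iff.rfl (and_congr Iff.rfl (and_congr Iff.rfl (h.exC a ih (fun m => ?_))))
      rw [NSimB_sub, NSimB_sub]
      exact NSimB_emb c S T f h m

theorem NSimO_reach (p : NOPat A) (T : RTree A) (a b : T.Node) (h : NSimO T p a b) :
    Relation.ReflTransGen T.E a b := by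
  induction p generalizing a with
  | here s sn ch =>
    rw [NSimO] at h
    rw [h.1]
  | step s sn ch el rest ih =>
    cases el with
    | none =>
      rw [NSimO] at h
      obtain ⟨-, -, -, m, e, hm⟩ := h
      exact (ih m hm).head e
    | some c =>
      rw [NSimO] at h
      obtain ⟨-, -, -, m, e, hm, -⟩ := h
      exact e.to_reflTransGen.trans (ih m hm)

theorem NSimO_sub (p : NOPat A) (T : RTree A) (n n' : T.Node) :
    (∃ h : Relation.ReflTransGen T.E n n',
      NSimO (T.subtree n) p (T.subtree n).root ⟨n', h⟩) ↔ NSimO T p n n' := by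
  constructor
  · rintro ⟨h, hs⟩
    exact (NSimO_emb p _ _ _ (REmb.sub T n) _ _).1 hs
  · intro hs
    exact ⟨NSimO_reach p T n n' hs, (NSimO_emb p _ _ _ (REmb.sub T n) _ _).2 hs⟩

theorem NSimL_append (T : RTree A) (l l' : List (Option (NBPat A) × NBPat A)) (n : T.Node) :
    NSimL T (l ++ l') n ↔ NSimL T l n ∧ NSimL T l' n := by
  induction l with
  | nil => simp [NSimL]
  | cons x r ih =>
    obtain ⟨_ | c, t⟩ := x
    · rw [List.cons_append, NSimL, NSimL, ih, and_assoc]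
    · rw [List.cons_append, NSimL, NSimL, ih, and_assoc]

theorem union_cond {L s s' sn sn' : Set A} {P Q : Prop} :
    (s ∪ s' ⊆ L ∧ (∀ p ∈ sn ∪ sn', p ∉ L) ∧ P ∧ Q) ↔
    (s ⊆ L ∧ (∀ p ∈ sn, p ∉ L) ∧ P) ∧ (s' ⊆ L ∧ (∀ p ∈ sn', p ∉ L) ∧ Q) := by
  simp only [Set.union_subset_iff, Set.mem_union, or_imp, forall_and]
  tauto

theorem NSimB_fuse (T : RTree A) (p q : NBPat A) (n : T.Node) :
    NSimB T (p.fuse q) n ↔ NSimB T p n ∧ NSimB T q n := by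
  obtain ⟨s, sn, ch⟩ := p
  obtain ⟨s', sn', ch'⟩ := q
  rw [NBPat.fuse, NSimB, NSimB, NSimB, NSimL_append, union_cond]

theorem NSimB_graft (T : RTree A) (p : NOPat A) (q : NBPat A) (n : T.Node) :
    NSimB T (p.graft q) n ↔ ∃ m, NSimO T p n m ∧ NSimB T q m := by
  induction p generalizing n with
  | here s sn ch =>
    obtain ⟨s', sn', ch'⟩ := q
    simp only [NOPat.graft, NSimB, NSimO, NSimL_append, union_cond, and_assoc, exists_eq_left]
  | step s sn ch el rest ih =>
    cases el with
    | none =>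
      simp only [NOPat.graft, NSimB, NSimO, NSimL_append, NSimL, ih]
      constructor
      · rintro ⟨h1, h2, h3, ⟨m, e, k, h4, h5⟩, -⟩
        exact ⟨k, ⟨h1, h2, h3, m, e, h4⟩, h5⟩
      · rintro ⟨k, ⟨h1, h2, h3, m, e, h4⟩, h5⟩
        exact ⟨h1, h2, h3, ⟨m, e, k, h4, h5⟩, trivial⟩
    | some c =>
      simp only [NOPat.graft, NSimB, NSimO, NSimL_append, NSimL, ih]
      constructor
      · rintro ⟨h1, h2, h3, ⟨m, e, ⟨k, h4, h5⟩, h6⟩, -⟩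
        exact ⟨k, ⟨h1, h2, h3, m, e, h4, h6⟩, h5⟩
      · rintro ⟨k, ⟨h1, h2, h3, m, e, h4, h6⟩, h5⟩
        exact ⟨h1, h2, h3, ⟨m, e, ⟨k, h4, h5⟩, h6⟩, trivial⟩

theorem NSimO_comp (T : RTree A) (p q : NOPat A) (n o : T.Node) :
    NSimO T (p.comp q) n o ↔ ∃ m, NSimO T p n m ∧ NSimO T q m o := by
  induction p generalizing n with
  | here s sn ch =>
    cases q with
    | here s' sn' ch' =>
      simp only [NOPat.comp, NSimO, NSimL_append, union_cond, and_assoc, exists_eq_left]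
      tauto
    | step s' sn' ch' el rest =>
      cases el <;>
      · simp only [NOPat.comp, NSimO, NSimL_append, and_assoc, exists_eq_left, union_cond]
  | step s sn ch el rest ih =>
    cases el with
    | none =>
      simp only [NOPat.comp, NSimO, ih]
      constructor
      · rintro ⟨h1, h2, h3, m, e, k, h4, h5⟩
        exact ⟨k, ⟨h1, h2, h3, m, e, h4⟩, h5⟩
      · rintro ⟨k, ⟨h1, h2, h3, m, e, h4⟩, h5⟩
        exact ⟨h1, h2, h3, m, e, k, h4, h5⟩
    | some c =>
      simp only [NOPat.comp, NSimO, ih]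
      constructor
      · rintro ⟨h1, h2, h3, m, e, ⟨k, h4, h5⟩, h6⟩
        exact ⟨k, ⟨h1, h2, h3, m, e, h4, h6⟩, h5⟩
      · rintro ⟨k, ⟨h1, h2, h3, m, e, h4, h6⟩, h5⟩
        exact ⟨h1, h2, h3, m, e, ⟨k, h4, h5⟩, h6⟩

theorem tree_cstar {N : Type} (E : N → N → Prop) (P : N → Prop)
    (hu : ∀ n m m', E m n → E m' n → m = m') (ha : ∀ n, ¬ Relation.TransGen E n n) (n m : N) :
    (∃ k, Relation.ReflTransGen (fun a b => E a b ∧ P b) n k ∧ E k m) ↔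
    (Relation.TransGen E n m ∧
      ∀ z, Relation.TransGen E n z → Relation.TransGen E z m → P z) := by
  constructor
  · rintro ⟨k, hk, e⟩
    induction hk generalizing m with
    | refl =>
      refine ⟨.single e, fun z h1 h2 => ?_⟩
      obtain ⟨w, hw, e'⟩ := Relation.TransGen.tail'_iff.1 h2
      obtain rfl := hu _ _ _ e e'
      exact (ha _ (h1.trans_left hw)).elim
    | tail _ e2 ih =>
      obtain ⟨h3, h4⟩ := ih _ e2.1
      refine ⟨h3.tail e, fun z h1 h2 => ?_⟩
      obtain ⟨w, hw, e'⟩ := Relation.TransGen.tail'_iff.1 h2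
      obtain rfl := hu _ _ _ e e'
      rcases Relation.reflTransGen_iff_eq_or_transGen.1 hw with rfl | hw
      · exact e2.2
      · exact h4 z h1 hw
  · rintro ⟨h, hz⟩
    induction h with
    | single e => exact ⟨n, .refl, e⟩
    | tail h e ih =>
      obtain ⟨k, hk, e'⟩ := ih (fun z h1 h2 => hz z h1 (h2.tail e))
      exact ⟨_, hk.tail ⟨e', hz _ h (.single e)⟩, e⟩

mutual
theorem main_N (T : RTree A) (hT : T.IsTree) (φ : CNFn A) (n : T.Node) :
    n ∈ CNFn.sat T φ ↔ NSimB T (ctNn φ) n :=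
  match φ with
  | .lab p => by simp [CNFn.sat, ctNn, NSimB, NSimL]
  | .nlab p => by simp [CNFn.sat, ctNn, NSimB, NSimL]
  | .top => by simp [CNFn.sat, ctNn, NSimB, NSimL]
  | .and φ ψ => by
    rw [CNFn.sat, ctNn, NSimB_fuse, ← main_N T hT φ n, ← main_N T hT ψ n]; rfl
  | .dia α φ => by
    rw [CNFn.sat, ctNn, NSimB_graft]
    exact exists_congr fun m => and_congr (main_P T hT α n m) (main_N T hT φ m)
theorem main_P (T : RTree A) (hT : T.IsTree) (α : CPFn A) (n n' : T.Node) :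
    CPFn.sem T α n n' ↔ NSimO T (ctPn α) n n' :=
  match α with
  | .child => by simp [CPFn.sem, ctPn, NSimO, NSimL]
  | .test φ => by
    have h := main_N T hT φ n
    rw [CPFn.sem, ctPn]
    beta_reduce
    rw [h]
    cases ctNn φ with
    | mk s sn ch => rw [NSimO, NSimB, eq_comm]
  | .comp α β => by
    rw [CPFn.sem, ctPn, NSimO_comp]
    exact exists_congr fun m => and_congr (main_P T hT α n m) (main_P T hT β m n')
  | .cstar φ => by
    have h := main_N T hT φ
    rw [CPFn.sem, ctPn]
    beta_reduce
    rw [tree_cstar T.E (fun b => b ∈ CNFn.sat T φ) hT.1.2.2.1 hT.1.2.2.2]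
    simp only [h, NSimO, NSimL, NSimB_sub]
    simp
end

/-- simulation characterization for CTP with negated labels: a
CTP^¬ node formula φ holds at a node n of a tree T iff there is a
negated-label-preserving simulation from ct(φ) into the pointed tree (T.n, n);
and analogously for CTP^¬ path formulas, with the output node mapped
accordingly. -/
theorem ctpneg_simulation (T : RTree A) (hT : T.IsTree) :
    (∀ (φ : CNFn A) (n : T.Node),
      n ∈ CNFn.sat T φ ↔ NSimB (T.subtree n) (ctNn φ) (T.subtree n).root) ∧
    (∀ (α : CPFn A) (n n' : T.Node),
      CPFn.sem T α n n' ↔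
        ∃ h : Relation.ReflTransGen T.E n n',
          NSimO (T.subtree n) (ctPn α) (T.subtree n).root ⟨n', h⟩) := by
  exact ⟨fun φ n => (main_N T hT φ n).trans (NSimB_sub _ T n).symm,
    fun α n n' => (main_P T hT α n n').trans (NSimO_sub _ T n n').symm⟩
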